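/- If n, m, a are nonnegative integers with n > m, n > 200, and L_n + L_m = 3^a, then n < 7.3×10^{14}·(log n)·(max{log(2n), 21/2})². -/

import Mathlib

/-- The Lucas sequence: `L 0 = 2`, `L 1 = 1`, `L (n+2) = L (n+1) + L n`. -/
def lucas : ℕ → ℕ
  | 0 => 2
  | 1 => 1
  | n + 2 => lucas (n + 1) + lucas n

/-- One period of the pairs `(L n, L (n+1))` modulo 1080. -/
def lucasPairs : List (ℕ × ℕ) :=
  [(2, 1), (1, 3), (3, 4), (4, 7), (7, 11), (11, 18),
   (18, 29), (29, 47), (47, 76), (76, 123), (123, 199), (199, 322),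
   (322, 521), (521, 843), (843, 284), (284, 47), (47, 331), (331, 378),
   (378, 709), (709, 7), (7, 716), (716, 723), (723, 359), (359, 2),
   (2, 361), (361, 363), (363, 724), (724, 7), (7, 731), (731, 738),
   (738, 389), (389, 47), (47, 436), (436, 483), (483, 919), (919, 322),
   (322, 161), (161, 483), (483, 644), (644, 47), (47, 691), (691, 738),
   (738, 349), (349, 7), (7, 356), (356, 363), (363, 719), (719, 2),
   (2, 721), (721, 723), (723, 364), (364, 7), (7, 371), (371, 378),
   (378, 749), (749, 47), (47, 796), (796, 843), (843, 559), (559, 322),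
   (322, 881), (881, 123), (123, 1004), (1004, 47), (47, 1051), (1051, 18),
   (18, 1069), (1069, 7), (7, 1076), (1076, 3), (3, 1079), (1079, 2)]

theorem lucasPairs_step : ∀ p ∈ lucasPairs, (p.2, (p.1 + p.2) % 1080) ∈ lucasPairs := by
  decide +kernel

theorem lucas_mem (n : ℕ) : (lucas n % 1080, lucas (n + 1) % 1080) ∈ lucasPairs := by
  induction n with
  | zero => decide +kernel
  | succ k ih =>
    have h := lucasPairs_step _ ih
    have e : lucas (k + 1 + 1) % 1080 = (lucas k % 1080 + lucas (k + 1) % 1080) % 1080 := by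
      simp only [lucas]
      omega
    rw [e]
    exact h

theorem lucas_table : ∀ p ∈ lucasPairs, ∀ q ∈ lucasPairs,
    ¬ ((p.1 + q.1) % 27 = 0 ∧ (p.1 + q.1) % 5 ≠ 0 ∧
      ((p.1 + q.1) % 8 = 1 ∨ (p.1 + q.1) % 8 = 3)) := by
  decide +kernel

theorem le_lucas (n : ℕ) : n ≤ lucas n ∧ 1 ≤ lucas n ∧ n + 1 ≤ lucas (n + 1) := by
  induction n with
  | zero => decide
  | succ k ih =>
    refine ⟨ih.2.2, by omega, ?_⟩
    simp only [lucas]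
    omega

theorem no_solution (n m a : ℕ) (hn : 200 < n) (h : lucas n + lucas m = 3 ^ a) : False := by
  have ha : 3 ≤ a := by
    by_contra hlt
    have h1 := (le_lucas n).1
    have h2 : 3 ^ a ≤ 3 ^ 3 := Nat.pow_le_pow_right (by norm_num) (by omega)
    omega
  obtain ⟨b, rfl⟩ := Nat.exists_eq_add_of_le ha
  have h27 : 3 ^ (3 + b) % 27 = 0 := by rw [pow_add]; omega
  have h5 : 3 ^ (3 + b) % 5 ≠ 0 := by
    intro h0
    have := Nat.Prime.dvd_of_dvd_pow (by norm_num : Nat.Prime 5) (Nat.dvd_of_mod_eq_zero h0)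
    omega
  have h8 : ∀ c : ℕ, 3 ^ c % 8 = 1 ∨ 3 ^ c % 8 = 3 := by
    intro c
    induction c with
    | zero => left; rfl
    | succ k ih => rw [pow_succ]; omega
  have h8' := h8 (3 + b)
  have ht := lucas_table _ (lucas_mem n) _ (lucas_mem m)
  dsimp only at ht
  rw [← h] at h27 h5 h8'
  apply ht
  omega

/-- If `n > m`, `n > 200` and `L n + L m = 3^a`, then
`n < 7.3×10¹⁴·(log n)·(max (log (2n)) (21/2))²`. -/
theorem n_lt_bound (n m a : ℕ) (hnm : m < n) (hn : 200 < n)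
    (h : lucas n + lucas m = 3 ^ a) :
    (n : ℝ) < 7.3e14 * Real.log n * max (Real.log (2 * (n : ℝ))) (21 / 2) ^ 2 :=
  (no_solution n m a hn h).elim
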